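/- Singly-weighted two-step sums: let λ be a Young diagram with at most d rows, let i, j ∈ [d], and assume λ + e_i is again a Young diagram, i.e. i = 1 or λ_{i−1} > λ_i. Then (i) ∑_{k=1}^{d} ∑_{ℓ=1}^{d} λ↑↑_k · g(k, ℓ) = (C_i + 1) · D_{d→ij}, and (ii) ∑_{k=1}^{d} ∑_{ℓ=1}^{d} (λ↑↑_ℓ + 1/Δ) · g(k, ℓ) = (C^{λ+e_i}_j + 1) · D_{d→ij}. -/

import Mathlib

open Finset

/-- The Weyl dimension polynomial `WD_p(mu) = prod_{1 <= a < b <= p} ((mu_a - mu_b) + (b - a))/(b - a)`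
of the integer tuple `(mu 1, ..., mu p)`. -/
def weylDim (p : ℕ) (μ : ℕ → ℤ) : ℚ :=
  ∏ a ∈ Finset.Icc 1 p, ∏ b ∈ Finset.Icc (a + 1) p,
    (((μ a : ℚ) - (μ b : ℚ)) + ((b : ℚ) - (a : ℚ))) / ((b : ℚ) - (a : ℚ))

/-- `addBox μ y = μ + e_y`: the tuple `μ` with `1` added in coordinate `y`. -/
def addBox (μ : ℕ → ℤ) (y : ℕ) : ℕ → ℤ := fun x => μ x + if x = y then 1 else 0

/-- The dimension ratio `D^μ_{k→y} = WD_k(μ + e_y)/WD_k(μ)` for `y ≤ k`, and `0` for `k < y`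
(division by zero evaluates to `0`). -/
def dimRatio (μ : ℕ → ℤ) (k y : ℕ) : ℚ :=
  if y ≤ k then weylDim k (addBox μ y) / weylDim k μ else 0

def intOf (lam : ℕ → ℕ) : ℕ → ℤ := fun x => (lam x : ℤ)

/-- `Δ = (λ_j − λ_i) + (i − j) + δ_{ij}`. -/
def Del (lam : ℕ → ℕ) (i j : ℕ) : ℚ :=
  (((lam j : ℚ) - (lam i : ℚ)) + ((i : ℚ) - (j : ℚ))) + (if i = j then 1 else 0)

/-- The partial-sum function `F(s, t)` of squared two-step Clebsch–Gordan coefficients. -/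
def Fcoef (lam : ℕ → ℕ) (i j : ℕ) (s t : ℕ) : ℚ :=
  if s ≤ t then dimRatio (intOf lam) s i * dimRatio (addBox (intOf lam) i) t j
  else
    dimRatio (intOf lam) t j * dimRatio (addBox (intOf lam) j) s i
      + 1 / Del lam i j ^ 2 *
          (dimRatio (intOf lam) t i * dimRatio (addBox (intOf lam) i) s j
            - dimRatio (intOf lam) t j * dimRatio (addBox (intOf lam) j) s i)

/-- The squared two-step Clebsch–Gordan coefficient `g(k, ℓ)`. -/
def gcoef (lam : ℕ → ℕ) (i j : ℕ) (k l : ℕ) : ℚ :=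
  Fcoef lam i j k l - Fcoef lam i j (k - 1) l - Fcoef lam i j k (l - 1)
    + Fcoef lam i j (k - 1) (l - 1)

/-- `D_{s→ij}`. -/
def dimR2 (lam : ℕ → ℕ) (i j s : ℕ) : ℚ :=
  if max i j ≤ s then weylDim s (addBox (addBox (intOf lam) i) j) / weylDim s (intOf lam)
  else 0

/-- `C^{λ+e_i}_j = λ_j + δ_{ij} − j`. -/
def rowContentAdd (lam : ℕ → ℕ) (i j : ℕ) : ℚ :=
  ((lam j : ℚ) + (if i = j then 1 else 0)) - (j : ℚ)

/-- The content `C_x = λ_x − x` of row `x`. -/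
def rowContent (lam : ℕ → ℕ) (x : ℕ) : ℚ := (lam x : ℚ) - (x : ℚ)

/-- The staircase transformation `λ↑↑_k = λ_k + d − 2k + 1`. -/
def staircase (d : ℕ) (lam : ℕ → ℕ) (k : ℕ) : ℤ :=
  (lam k : ℤ) + (d : ℤ) - 2 * (k : ℤ) + 1

theorem sum_Icc_one_sub_pred (h : ℕ → ℚ) (d : ℕ) :
    ∑ k ∈ Finset.Icc 1 d, (h k - h (k - 1)) = h d - h 0 := by
  induction d with
  | zero => simp
  | succ n ih =>
    rw [Finset.sum_Icc_succ_top (by omega), ih, Nat.add_sub_cancel]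
    ring

theorem weylDim_ne_zero {p : ℕ} {μ : ℕ → ℤ}
    (hμ : ∀ a b, 1 ≤ a → a < b → b ≤ p → μ b ≤ μ a) : weylDim p μ ≠ 0 := by
  refine Finset.prod_ne_zero_iff.2 fun a ha => Finset.prod_ne_zero_iff.2 fun b hb => ?_
  rw [Finset.mem_Icc] at ha hb
  have h1 : (μ b : ℚ) ≤ μ a := by exact_mod_cast hμ a b ha.1 (by omega) hb.2
  have h2 : (a : ℚ) < b := by exact_mod_cast (show a < b by omega)
  exact div_ne_zero (by linarith) (by linarith)

theorem weylDim_eq_zero {p : ℕ} {μ : ℕ → ℤ} {a b : ℕ} (ha : 1 ≤ a) (hab : a < b) (hb : b ≤ p)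
    (h : ((μ a : ℚ) - (μ b : ℚ)) + ((b : ℚ) - (a : ℚ)) = 0) : weylDim p μ = 0 := by
  refine Finset.prod_eq_zero (Finset.mem_Icc.2 ⟨ha, by omega⟩) ?_
  refine Finset.prod_eq_zero (Finset.mem_Icc.2 ⟨hab, hb⟩) ?_
  rw [h, zero_div]

theorem exists_factor_of_weylDim_eq_zero {p : ℕ} {μ : ℕ → ℤ} (h : weylDim p μ = 0) :
    ∃ a b, 1 ≤ a ∧ a < b ∧ b ≤ p ∧ ((μ a : ℚ) - (μ b : ℚ)) + ((b : ℚ) - (a : ℚ)) = 0 := by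
  obtain ⟨a, ha, h⟩ := Finset.prod_eq_zero_iff.1 h
  obtain ⟨b, hb, h⟩ := Finset.prod_eq_zero_iff.1 h
  rw [Finset.mem_Icc] at ha hb
  refine ⟨a, b, ha.1, by omega, hb.2, ?_⟩
  have h2 : (a : ℚ) < b := by exact_mod_cast (show a < b by omega)
  exact (div_eq_zero_iff.1 h).resolve_right (by linarith)

theorem weylDim_succ (p : ℕ) (μ : ℕ → ℤ) :
    weylDim (p + 1) μ = weylDim p μ * ∏ a ∈ Finset.Icc 1 p,
      ((((μ a : ℚ) - (μ (p + 1) : ℚ)) + (((p + 1 : ℕ) : ℚ) - (a : ℚ))) /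
        (((p + 1 : ℕ) : ℚ) - (a : ℚ))) := by
  unfold weylDim
  rw [Finset.prod_Icc_succ_top (by omega), Finset.Icc_eq_empty (a := p + 1 + 1) (by omega),
    Finset.prod_empty, mul_one, ← Finset.prod_mul_distrib]
  refine Finset.prod_congr rfl fun a ha => ?_
  rw [Finset.mem_Icc] at ha
  rw [Finset.prod_Icc_succ_top (by omega)]

theorem addBox_comm (μ : ℕ → ℤ) (x y : ℕ) :
    addBox (addBox μ x) y = addBox (addBox μ y) x := by
  funext z
  simp only [addBox]
  ring

theorem dimRatio_of_lt {μ : ℕ → ℤ} {k y : ℕ} (h : k < y) : dimRatio μ k y = 0 :=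
  if_neg (by omega)

/-- One-step recursion of the dimension ratios in the number of rows. -/
theorem dimRatio_succ_sub_mul {μ : ℕ → ℤ} {k y : ℕ} (hy : 1 ≤ y) (hyk : y ≤ k)
    (hμ : ∀ a b, 1 ≤ a → a < b → b ≤ k + 1 → μ b ≤ μ a) :
    (dimRatio μ (k + 1) y - dimRatio μ k y) *
      (((μ y : ℚ) - y) - ((μ (k + 1) : ℚ) - (k + 1))) = dimRatio μ k y := by
  have h1 : (μ (k + 1) : ℚ) ≤ μ y := by exact_mod_cast hμ y (k + 1) hy (by omega) le_rfl
  have h2 : (y : ℚ) ≤ k := by exact_mod_cast hyk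
  have hx : ((μ y : ℚ) - (μ (k + 1) : ℚ)) + (((k + 1 : ℕ) : ℚ) - (y : ℚ)) ≠ 0 := by
    push_cast
    linarith
  have hw := weylDim_ne_zero (p := k) fun a b ha hab hb => hμ a b ha hab (by omega)
  have hw' := weylDim_ne_zero hμ
  have hprod : ∏ a ∈ Finset.Icc 1 k,
      ((((addBox μ y a : ℚ) - (addBox μ y (k + 1) : ℚ)) + (((k + 1 : ℕ) : ℚ) - (a : ℚ))) /
        (((k + 1 : ℕ) : ℚ) - (a : ℚ))) =
      (∏ a ∈ Finset.Icc 1 k, ((((μ a : ℚ) - (μ (k + 1) : ℚ)) + (((k + 1 : ℕ) : ℚ) - (a : ℚ))) /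
        (((k + 1 : ℕ) : ℚ) - (a : ℚ)))) *
      (1 + 1 / (((μ y : ℚ) - (μ (k + 1) : ℚ)) + (((k + 1 : ℕ) : ℚ) - (y : ℚ)))) := by
    have hite : (1 + 1 / (((μ y : ℚ) - (μ (k + 1) : ℚ)) + (((k + 1 : ℕ) : ℚ) - (y : ℚ)))) =
        ∏ a ∈ Finset.Icc 1 k, if a = y then
          (1 + 1 / (((μ y : ℚ) - (μ (k + 1) : ℚ)) + (((k + 1 : ℕ) : ℚ) - (y : ℚ)))) else 1 := by
      rw [Finset.prod_ite_eq' _ _ fun _ => _, if_pos (Finset.mem_Icc.2 ⟨hy, hyk⟩)]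
    rw [hite, ← Finset.prod_mul_distrib]
    refine Finset.prod_congr rfl fun a _ => ?_
    have hk : k + 1 ≠ y := by omega
    by_cases hay : a = y
    · subst hay
      simp only [addBox, if_true, if_neg hk, Int.cast_add, Int.cast_one, add_zero]
      rw [div_mul_eq_mul_div, mul_add, mul_one_div_cancel hx]
      ring
    · simp [addBox, hay, hk]
  rw [weylDim_succ] at hw'
  have hP := right_ne_zero_of_mul hw'
  rw [dimRatio, dimRatio, if_pos (by omega), if_pos hyk, weylDim_succ, weylDim_succ k μ, hprod]
  generalize (∏ a ∈ Finset.Icc 1 k, ((((μ a : ℚ) - (μ (k + 1) : ℚ)) +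
    (((k + 1 : ℕ) : ℚ) - (a : ℚ))) / (((k + 1 : ℕ) : ℚ) - (a : ℚ)))) = P at hP ⊢
  have hx' : ((μ y : ℚ) - y) - ((μ (k + 1) : ℚ) - (k + 1)) =
      ((μ y : ℚ) - (μ (k + 1) : ℚ)) + (((k + 1 : ℕ) : ℚ) - (y : ℚ)) := by
    push_cast
    ring
  rw [hx']
  generalize ((μ y : ℚ) - (μ (k + 1) : ℚ)) + (((k + 1 : ℕ) : ℚ) - (y : ℚ)) = x at hx ⊢
  field_simp
  ring

/-- The staircase-weighted sum of the increments of the dimension ratios. -/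
theorem sum_staircase_mul_dimRatio {lam : ℕ → ℕ} {y : ℕ} (hy : 1 ≤ y) (d : ℕ)
    (hlam : ∀ a b, 1 ≤ a → a < b → b ≤ d → lam b ≤ lam a) :
    ∑ k ∈ Finset.Icc 1 d, (staircase d lam k : ℚ) *
        (dimRatio (intOf lam) k y - dimRatio (intOf lam) (k - 1) y) =
      (rowContent lam y + 1) * dimRatio (intOf lam) d y := by
  induction d with
  | zero => simp [dimRatio_of_lt (show 0 < y by omega)]
  | succ n ih =>
    have ih := ih fun a b ha hab hb => hlam a b ha hab (by omega)
    have hstep : ∀ k, (staircase (n + 1) lam k : ℚ) = staircase n lam k + 1 := by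
      intro k
      simp only [staircase]
      push_cast
      ring
    rw [Finset.sum_Icc_succ_top (by omega), Nat.add_sub_cancel]
    have hsum : ∑ k ∈ Finset.Icc 1 n, (staircase (n + 1) lam k : ℚ) *
        (dimRatio (intOf lam) k y - dimRatio (intOf lam) (k - 1) y) =
        (rowContent lam y + 1) * dimRatio (intOf lam) n y + dimRatio (intOf lam) n y := by
      simp only [hstep, add_mul, one_mul, Finset.sum_add_distrib]
      rw [ih, sum_Icc_one_sub_pred fun k => dimRatio (intOf lam) k y,
        dimRatio_of_lt (show 0 < y by omega)]
      ring
    rw [hsum]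
    rcases lt_trichotomy (n + 1) y with h | h | h
    · rw [dimRatio_of_lt h, dimRatio_of_lt (show n < y by omega)]
      ring
    · rw [dimRatio_of_lt (show n < y by omega)]
      subst h
      simp only [staircase, rowContent]
      push_cast
      ring
    · have hrec := dimRatio_succ_sub_mul (μ := intOf lam) hy (show y ≤ n by omega)
        fun a b ha hab hb => Int.ofNat_le.2 (hlam a b ha hab hb)
      simp only [staircase, rowContent, intOf] at hrec ⊢
      push_cast at hrec ⊢
      linear_combination -hrec

theorem dimRatio_mul_dimRatio_addBox {μ : ℕ → ℤ} {d x y : ℕ} (hx : x ≤ d) (hy : y ≤ d)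
    (h : weylDim d (addBox μ x) ≠ 0) :
    dimRatio μ d x * dimRatio (addBox μ x) d y =
      weylDim d (addBox (addBox μ x) y) / weylDim d μ := by
  rw [dimRatio, dimRatio, if_pos hx, if_pos hy]
  field_simp

theorem Fcoef_zero_left {lam : ℕ → ℕ} {i : ℕ} (hi : 1 ≤ i) (j t : ℕ) :
    Fcoef lam i j 0 t = 0 := by
  rw [Fcoef, if_pos (Nat.zero_le t), dimRatio_of_lt (show 0 < i by omega), zero_mul]

theorem Fcoef_zero_right {lam : ℕ → ℕ} {i j : ℕ} (hi : 1 ≤ i) (hj : 1 ≤ j) (s : ℕ) :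
    Fcoef lam i j s 0 = 0 := by
  have h : ∀ μ, dimRatio μ 0 j = 0 := fun μ => dimRatio_of_lt (by omega)
  have h' : ∀ μ, dimRatio μ 0 i = 0 := fun μ => dimRatio_of_lt (by omega)
  simp [Fcoef, h, h']

theorem sum_gcoef_right {lam : ℕ → ℕ} {i j : ℕ} (hi : 1 ≤ i) (hj : 1 ≤ j) (d k : ℕ) :
    ∑ l ∈ Finset.Icc 1 d, gcoef lam i j k l = Fcoef lam i j k d - Fcoef lam i j (k - 1) d := by
  have h := sum_Icc_one_sub_pred (fun l => Fcoef lam i j k l - Fcoef lam i j (k - 1) l) d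
  simp only [Fcoef_zero_right hi hj, sub_zero] at h
  rw [← h]
  refine Finset.sum_congr rfl fun l _ => ?_
  rw [gcoef]
  ring

theorem sum_gcoef_left {lam : ℕ → ℕ} {i : ℕ} (hi : 1 ≤ i) (j d l : ℕ) :
    ∑ k ∈ Finset.Icc 1 d, gcoef lam i j k l = Fcoef lam i j d l - Fcoef lam i j d (l - 1) := by
  have h := sum_Icc_one_sub_pred (fun k => Fcoef lam i j k l - Fcoef lam i j k (l - 1)) d
  simp only [Fcoef_zero_left hi, sub_zero] at h
  rw [← h]
  refine Finset.sum_congr rfl fun k _ => ?_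
  rw [gcoef]
  ring

/-- The two orders of adding boxes agree up to a defect that `1 - 1 / Δ²` annihilates. -/
theorem one_sub_inv_sq_Del_mul {lam : ℕ → ℕ} {d i j : ℕ} (hid : i ≤ d) (hjd : j ≤ d)
    (hlam : ∀ a b, 1 ≤ a → a < b → b ≤ d → lam b ≤ lam a) :
    (1 - 1 / Del lam i j ^ 2) *
        (dimRatio (intOf lam) d j * dimRatio (addBox (intOf lam) j) d i) =
      (1 - 1 / Del lam i j ^ 2) *
        (weylDim d (addBox (addBox (intOf lam) i) j) / weylDim d (intOf lam)) := by
  by_cases hij : i = j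
  · simp [Del, hij]
  by_cases hw : weylDim d (addBox (intOf lam) j) = 0
  · obtain ⟨a, b, ha, hab, hb, h⟩ := exists_factor_of_weylDim_eq_zero hw
    have h1 : (lam b : ℚ) ≤ lam a := by exact_mod_cast hlam a b ha hab hb
    have h2 : (a : ℚ) < b := by exact_mod_cast hab
    obtain rfl : b = j := by
      by_contra hbj
      by_cases haj : a = j <;> simp [addBox, intOf, hbj, haj] at h <;> subst_vars <;> linarith
    have hab' : a ≠ b := hab.ne
    simp only [addBox, intOf, if_neg hab', if_true, add_zero] at h
    push_cast at h
    by_cases hia : i = a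
    · subst hia
      have hD : Del lam i b = -1 := by
        rw [Del, if_neg hij]
        linear_combination -h
      simp [hD]
    · have hw2 : weylDim d (addBox (addBox (intOf lam) i) b) = 0 := by
        refine weylDim_eq_zero ha hab hb ?_
        simp only [addBox, intOf, if_neg (Ne.symm hia), if_neg (Ne.symm hij), if_neg hab', if_true]
        push_cast
        linear_combination h
      simp [dimRatio, hw, hw2]
  · rw [dimRatio_mul_dimRatio_addBox hjd hid hw, addBox_comm]

theorem singly_weighted_two_step_sums
    (d : ℕ) (hd : 1 ≤ d) (lam : ℕ → ℕ)
    (hlam : ∀ k, 1 ≤ k → k + 1 ≤ d → lam (k + 1) ≤ lam k)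
    (i j : ℕ) (hi : i ∈ Finset.Icc 1 d) (hj : j ∈ Finset.Icc 1 d)
    (hvalid : i = 1 ∨ lam i < lam (i - 1)) :
    (∑ k ∈ Finset.Icc 1 d, ∑ l ∈ Finset.Icc 1 d,
          (staircase d lam k : ℚ) * gcoef lam i j k l
        = (rowContent lam i + 1) * dimR2 lam i j d) ∧
      (∑ k ∈ Finset.Icc 1 d, ∑ l ∈ Finset.Icc 1 d,
          ((staircase d lam l : ℚ) + 1 / Del lam i j) * gcoef lam i j k l
        = (rowContentAdd lam i j + 1) * dimR2 lam i j d) := by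
  rw [Finset.mem_Icc] at hi hj
  obtain ⟨hi1, hid⟩ := hi
  obtain ⟨hj1, hjd⟩ := hj
  have hmono : ∀ a b, 1 ≤ a → a ≤ b → b ≤ d → lam b ≤ lam a := by
    intro a b ha hab
    induction b, hab using Nat.le_induction with
    | base => exact fun _ => le_rfl
    | succ b hab ih =>
      exact fun hb => (hlam b (by omega) hb).trans (ih (by omega))
  have hanti : ∀ a b, 1 ≤ a → a < b → b ≤ d → lam b ≤ lam a :=
    fun a b ha hab hb => hmono a b ha hab.le hb
  have hw : weylDim d (addBox (intOf lam) i) ≠ 0 := by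
    refine weylDim_ne_zero fun a b ha hab hb => ?_
    have h1 := hanti a b ha hab hb
    simp only [addBox, intOf]
    by_cases hbi : b = i
    · have h2 := hmono a (i - 1) ha (by omega) (by omega)
      have h3 := hvalid.resolve_left (by omega)
      subst hbi
      rw [if_pos rfl, if_neg hab.ne]
      omega
    · rw [if_neg hbi]
      split_ifs <;> omega
  have hR2 : dimR2 lam i j d =
      weylDim d (addBox (addBox (intOf lam) i) j) / weylDim d (intOf lam) :=
    if_pos (max_le hid hjd)
  have hP : dimRatio (intOf lam) d i * dimRatio (addBox (intOf lam) i) d j = dimR2 lam i j d := by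
    rw [hR2, dimRatio_mul_dimRatio_addBox hid hjd hw]
  have hQ := one_sub_inv_sq_Del_mul (lam := lam) hid hjd hanti
  rw [← hR2] at hQ
  have hSi := sum_staircase_mul_dimRatio hi1 d hanti
  have hSj := sum_staircase_mul_dimRatio hj1 d hanti
  constructor
  · have hF : ∀ k ≤ d, Fcoef lam i j k d =
        dimRatio (intOf lam) k i * dimRatio (addBox (intOf lam) i) d j := fun k hk => if_pos hk
    calc _ = ∑ k ∈ Finset.Icc 1 d, ((staircase d lam k : ℚ) *
          (dimRatio (intOf lam) k i - dimRatio (intOf lam) (k - 1) i)) *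
            dimRatio (addBox (intOf lam) i) d j := by
          refine Finset.sum_congr rfl fun k hk => ?_
          rw [Finset.mem_Icc] at hk
          rw [← Finset.mul_sum, sum_gcoef_right hi1 hj1, hF k hk.2, hF (k - 1) (by omega)]
          ring
      _ = _ := by rw [← Finset.sum_mul, hSi, mul_assoc, hP]
  · have hF : ∀ t ≤ d, Fcoef lam i j d t =
        (1 - 1 / Del lam i j ^ 2) *
            (dimRatio (intOf lam) t j * dimRatio (addBox (intOf lam) j) d i) +
          1 / Del lam i j ^ 2 *
            (dimRatio (intOf lam) t i * dimRatio (addBox (intOf lam) i) d j) := by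
      intro t ht
      rcases ht.eq_or_lt with rfl | ht
      · rw [hQ, hP, Fcoef, if_pos le_rfl, hP]
        ring
      · rw [Fcoef, if_neg (by omega)]
        ring
    have hFd : Fcoef lam i j d d = dimR2 lam i j d := by rw [Fcoef, if_pos le_rfl, hP]
    have hstair : ∑ l ∈ Finset.Icc 1 d, (staircase d lam l : ℚ) *
        (Fcoef lam i j d l - Fcoef lam i j d (l - 1)) =
        (1 - 1 / Del lam i j ^ 2) * dimRatio (addBox (intOf lam) j) d i *
            ((rowContent lam j + 1) * dimRatio (intOf lam) d j) +
          1 / Del lam i j ^ 2 * dimRatio (addBox (intOf lam) i) d j *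
            ((rowContent lam i + 1) * dimRatio (intOf lam) d i) := by
      rw [← hSi, ← hSj, Finset.mul_sum, Finset.mul_sum, ← Finset.sum_add_distrib]
      refine Finset.sum_congr rfl fun l hl => ?_
      rw [Finset.mem_Icc] at hl
      rw [hF l hl.2, hF (l - 1) (by omega)]
      ring
    have hDel : rowContent lam j + (rowContent lam i - rowContent lam j) / Del lam i j ^ 2 +
        1 / Del lam i j = rowContentAdd lam i j := by
      by_cases hij : i = j
      · simp [hij, Del, rowContent, rowContentAdd]
        ring
      · have hD : rowContent lam i - rowContent lam j = -Del lam i j := by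
          rw [Del, rowContent, rowContent, if_neg hij]
          ring
        rw [hD, rowContentAdd, if_neg hij, rowContent]
        by_cases h0 : Del lam i j = 0
        · simp [h0]
        · field_simp
          ring
    rw [Finset.sum_comm]
    calc _ = ∑ l ∈ Finset.Icc 1 d, ((staircase d lam l : ℚ) *
            (Fcoef lam i j d l - Fcoef lam i j d (l - 1)) +
          1 / Del lam i j * (Fcoef lam i j d l - Fcoef lam i j d (l - 1))) := by
          refine Finset.sum_congr rfl fun l _ => ?_
          rw [← Finset.mul_sum, sum_gcoef_left hi1, add_mul]
      _ = _ := by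
          rw [Finset.sum_add_distrib, ← Finset.mul_sum, hstair,
            sum_Icc_one_sub_pred fun l => Fcoef lam i j d l, Fcoef_zero_right hi1 hj1, hFd, ← hDel]
          linear_combination (rowContent lam j + 1) * hQ +
            1 / Del lam i j ^ 2 * (rowContent lam i + 1) * hP
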